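/- For every two-column standard tableau t of size n, the element E_t ∈ TL_n^ℚ is a primitive idempotent: E_t is a nonzero idempotent, and E_t cannot be written as e + e' with e, e' nonzero idempotents of TL_n^ℚ satisfying e·e' = e'·e = 0. -/

import Mathlib

/-- Relations defining the Temperley–Lieb algebra with loop parameter `2`,
on generators `u_1, …, u_{n-1}` (indexed by `Fin (n-1)`). -/
inductive TLRel (R : Type) [CommRing R] (n : ℕ) :
    FreeAlgebra R (Fin (n - 1)) → FreeAlgebra R (Fin (n - 1)) → Prop
  | sq (i : Fin (n - 1)) :
      TLRel R n (FreeAlgebra.ι R i * FreeAlgebra.ι R i) (2 * FreeAlgebra.ι R i)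
  | braid (i j : Fin (n - 1)) (h : Nat.dist i.val j.val = 1) :
      TLRel R n (FreeAlgebra.ι R i * FreeAlgebra.ι R j * FreeAlgebra.ι R i) (FreeAlgebra.ι R i)
  | comm (i j : Fin (n - 1)) (h : 1 < Nat.dist i.val j.val) :
      TLRel R n (FreeAlgebra.ι R i * FreeAlgebra.ι R j) (FreeAlgebra.ι R j * FreeAlgebra.ι R i)

/-- The Temperley–Lieb algebra `TL_n` over `R`, with loop parameter `2`. -/
abbrev TL (R : Type) [CommRing R] (n : ℕ) : Type := RingQuot (TLRel R n)

/-- The generator `u_{i+1}` of the Temperley–Lieb algebra. -/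
noncomputable def TLu (R : Type) [CommRing R] (n : ℕ) (i : Fin (n - 1)) : TL R n :=
  RingQuot.mkAlgHom R (TLRel R n) (FreeAlgebra.ι R i)


/-- A two-column standard Young tableau of size `n`, encoded by the function
`col : Fin n → Fin 2` recording the column (`0` = first, `1` = second) containing
the entry `j+1`, subject to the ballot (lattice word) condition, which is
equivalent to standardness. -/
structure TwoColTab (n : ℕ) where
  col : Fin n → Fin 2
  ballot : ∀ m : Fin n,
    (Finset.univ.filter fun i : Fin n => i ≤ m ∧ col i = 1).card ≤
    (Finset.univ.filter fun i : Fin n => i ≤ m ∧ col i = 0).card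

theorem TwoColTab.ext' {n : ℕ} : ∀ {s t : TwoColTab n}, s.col = t.col → s = t
  | ⟨a, _⟩, ⟨b, _⟩, h => by
      obtain rfl : a = b := h
      rfl

noncomputable instance (n : ℕ) : Fintype (TwoColTab n) :=
  Fintype.ofInjective TwoColTab.col (fun _ _ h => TwoColTab.ext' h)

/-- The content `c_t(j+1) = (column of j+1) − (row of j+1)` of the entry `j+1`,
computed from the column word `c`: if `j+1` lies in column `k ∈ {1,2}` then its row
is the number of `i ≤ j+1` lying in column `k`, and its content is `k − row`. -/
def colContent {n : ℕ} (c : Fin n → Fin 2) (j : Fin n) : ℤ :=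
  if c j = 0 then
    1 - ((Finset.univ.filter fun i : Fin n => i ≤ j ∧ c i = 0).card : ℤ)
  else
    2 - ((Finset.univ.filter fun i : Fin n => i ≤ j ∧ c i = 1).card : ℤ)

/-- The content function of a two-column standard tableau. -/
def tabContent {n : ℕ} (t : TwoColTab n) (j : Fin n) : ℤ := colContent t.col j

/-- Membership in the `p`-class of the one-column standard tableau `t_n`
(whose content at the entry `j+1` is `−j`), expressed on column words. -/
def inOneColClass (p n : ℕ) (c : Fin n → Fin 2) : Prop :=
  ∀ j : Fin n, ((colContent c j : ℤ) : ZMod p) = ((-(j.val : ℤ) : ℤ) : ZMod p)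

/-- Two tableaux are in the same `p`-class if their contents agree modulo `p`. -/
def pClassEq (p n : ℕ) (s t : TwoColTab n) : Prop :=
  ∀ j : Fin n, ((tabContent s j : ℤ) : ZMod p) = ((tabContent t j : ℤ) : ZMod p)

/-- The one-column standard tableau `t_n`. -/
def oneColTab (n : ℕ) : TwoColTab n :=
  ⟨fun _ => 0, by intro m; simp⟩

/-- The group algebra `R𝔖_n` of the symmetric group on `{1, …, n}`. -/
abbrev SymGrpAlg (R : Type) [CommRing R] (n : ℕ) : Type := MonoidAlgebra R (Equiv.Perm (Fin n))

/-- The simple transposition `s_{i+1} = (i+1, i+2)` (1-based) in `𝔖_n`, for `i : Fin (n-1)`. -/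
def simpleT (n : ℕ) (i : Fin (n - 1)) : Equiv.Perm (Fin n) :=
  Equiv.swap ⟨i.val, by have := i.isLt; omega⟩ ⟨i.val + 1, by have := i.isLt; omega⟩

/-- The Jucys–Murphy element `L_{l+1} = (1,l+1) + (2,l+1) + ⋯ + (l,l+1)` (1-based)
in the group algebra, for `l : Fin n`; in particular `L_1 = 0`. -/
noncomputable def JMelt (R : Type) [CommRing R] (n : ℕ) (l : Fin n) : SymGrpAlg R n :=
  ∑ j ∈ Finset.univ.filter (fun j : Fin n => j < l),
    MonoidAlgebra.of R (Equiv.Perm (Fin n)) (Equiv.swap j l)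

/-- The set `𝒞` of all contents `c_s(i)` of entries of two-column standard tableaux of
size `n`, as a finite set of integers. -/
noncomputable def ContSet (n : ℕ) : Finset ℤ :=
  ((Finset.univ : Finset ((Fin n → Fin 2) × Fin n)).filter fun x =>
      ∀ m : Fin n,
        (Finset.univ.filter fun i : Fin n => i ≤ m ∧ x.1 i = 1).card ≤
        (Finset.univ.filter fun i : Fin n => i ≤ m ∧ x.1 i = 0).card).image
    fun x => colContent x.1 x.2

/-- The seminormal idempotent
`E_t = ∏_{c ∈ 𝒞} ∏_{1 ≤ i ≤ n, c_t(i) ≠ c} (𝐋_i − c)/(c_t(i) − c)`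
attached to the content function of the column word `c`; here `L : Fin n → TL ℚ n`
is the family of Jucys–Murphy elements `𝐋_i` of `TL_n^ℚ`.  (All the factors commute,
so the ordered product below agrees with the usual product.) -/
noncomputable def EeltC (n : ℕ) (L : Fin n → TL ℚ n) (c : Fin n → Fin 2) : TL ℚ n :=
  (((ContSet n).sort (· ≤ ·)).map fun d =>
    (((List.finRange n).filter fun i => colContent c i ≠ d).map fun i =>
      (((colContent c i - d : ℤ) : ℚ))⁻¹ • (L i - (d : TL ℚ n))).prod).prod

/-- The seminormal idempotent `E_t` of a two-column standard tableau `t`. -/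
noncomputable def Eelt (n : ℕ) (L : Fin n → TL ℚ n) (t : TwoColTab n) : TL ℚ n :=
  EeltC n L t.col

section TemperleyLiebQuotient

variable {n : ℕ}

/-- The first `k` points of `Fin n`. -/
def initialPoints (n k : ℕ) : Finset (Fin n) :=
  Finset.univ.filter fun j : Fin n => (j : ℕ) < k

@[simp]
theorem mem_initialPoints {n k : ℕ} {j : Fin n} : j ∈ initialPoints n k ↔ (j : ℕ) < k := by
  simp [initialPoints]

theorem card_initialPoints {n k : ℕ} (hk : k ≤ n) : (initialPoints n k).card = k := by
  have : (initialPoints n k).map Fin.valEmbedding = Finset.range k := by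
    ext j
    simp only [Finset.mem_map, mem_initialPoints, Fin.valEmbedding_apply, Finset.mem_range]
    exact ⟨by rintro ⟨i, hi, rfl⟩; exact hi, fun hj => ⟨⟨j, by omega⟩, hj, rfl⟩⟩
  rw [← Finset.card_map Fin.valEmbedding, this, Finset.card_range]

/-- The subgroup of permutations of `Fin n` moving only the first `k` points. -/
def youngSubgroup (n k : ℕ) : Subgroup (Equiv.Perm (Fin n)) :=
  fixingSubgroup (Equiv.Perm (Fin n)) {i : Fin n | k ≤ (i : ℕ)}

theorem mem_youngSubgroup {k : ℕ} {g : Equiv.Perm (Fin n)} :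
    g ∈ youngSubgroup n k ↔ ∀ i : Fin n, k ≤ (i : ℕ) → g i = i := by
  simp [youngSubgroup, mem_fixingSubgroup_iff]

theorem youngSubgroup_mono {k l : ℕ} (h : k ≤ l) : youngSubgroup n k ≤ youngSubgroup n l := by
  intro g hg
  rw [mem_youngSubgroup] at hg ⊢
  exact fun i hi => hg i (h.trans hi)

theorem swap_mem_youngSubgroup {k : ℕ} {i j : Fin n} (hi : (i : ℕ) < k) (hj : (j : ℕ) < k) :
    Equiv.swap i j ∈ youngSubgroup n k := by
  rw [mem_youngSubgroup]
  intro l hl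
  exact Equiv.swap_apply_of_ne_of_ne (by rintro rfl; omega) (by rintro rfl; omega)

theorem apply_lt_of_mem_youngSubgroup {k l : ℕ} {g : Equiv.Perm (Fin n)}
    (hg : g ∈ youngSubgroup n k) (hkl : k ≤ l) {i : Fin n} (hi : (i : ℕ) < l) :
    ((g i : Fin n) : ℕ) < l := by
  by_contra! h
  have := g.injective (mem_youngSubgroup.1 hg (g i) (hkl.trans h))
  rw [this] at h
  omega

theorem apply_lt_iff_of_mem_youngSubgroup {k l : ℕ} {g : Equiv.Perm (Fin n)}
    (hg : g ∈ youngSubgroup n k) (hkl : k ≤ l) {i : Fin n} :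
    ((g i : Fin n) : ℕ) < l ↔ (i : ℕ) < l := by
  refine ⟨fun h => ?_, apply_lt_of_mem_youngSubgroup hg hkl⟩
  simpa using apply_lt_of_mem_youngSubgroup (inv_mem hg) hkl h

theorem map_mul_map_swap {A : Type*} [Monoid A] (β : Equiv.Perm (Fin n) →* A)
    (g : Equiv.Perm (Fin n)) (i j : Fin n) :
    β g * β (Equiv.swap i j) = β (Equiv.swap (g i) (g j)) * β g := by
  rw [← map_mul, ← map_mul, Equiv.mul_swap_eq_swap_mul]

theorem exists_mul_swap_of_mem_youngSubgroup_succ {k : ℕ} (hk : k < n) {g : Equiv.Perm (Fin n)}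
    (hg : g ∈ youngSubgroup n (k + 1)) :
    g ∈ youngSubgroup n k ∨ ∃ h ∈ youngSubgroup n k, ∃ j : Fin n, (j : ℕ) < k ∧
      g = h * Equiv.swap j ⟨k, hk⟩ := by
  by_cases hfix : g ⟨k, hk⟩ = ⟨k, hk⟩
  · left
    rw [mem_youngSubgroup] at hg ⊢
    intro i hi
    rcases hi.eq_or_lt with h | h
    · obtain rfl : i = ⟨k, hk⟩ := Fin.ext h.symm
      exact hfix
    · exact hg i h
  · right
    have hj : ((g⁻¹ ⟨k, hk⟩ : Fin n) : ℕ) < k := by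
      have h1 := apply_lt_of_mem_youngSubgroup (inv_mem hg) le_rfl (i := ⟨k, hk⟩) (by simp)
      have h2 : ((g⁻¹ ⟨k, hk⟩ : Fin n) : ℕ) ≠ k := fun h => hfix <| by
        have : g⁻¹ ⟨k, hk⟩ = ⟨k, hk⟩ := Fin.ext h
        rw [Equiv.Perm.inv_eq_iff_eq] at this
        exact this.symm
      omega
    refine ⟨g * Equiv.swap (g⁻¹ ⟨k, hk⟩) ⟨k, hk⟩, ?_, g⁻¹ ⟨k, hk⟩, hj, by simp [mul_assoc]⟩
    rw [mem_youngSubgroup] at hg ⊢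
    intro i hi
    rcases hi.eq_or_lt with h | h
    · obtain rfl : i = ⟨k, hk⟩ := Fin.ext h.symm
      simp
    · rw [Equiv.Perm.mul_apply, Equiv.swap_apply_of_ne_of_ne (by rintro rfl; omega)
        (by rintro rfl; simp at h)]
      exact hg i h

variable {A : Type*} [Ring A] (β : Equiv.Perm (Fin n) →* A)

/-- The `k`-th Jucys–Murphy element (counted from `0`), with value `0` for `n ≤ k`. -/
def jucysMurphy (k : ℕ) : A :=
  if hk : k < n then ∑ j ∈ initialPoints n k, β (Equiv.swap j ⟨k, hk⟩) else 0

/-- Twice the sum of all transpositions of the first `k` points, plus `k`. -/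
def swapSum (k : ℕ) : A :=
  ∑ i ∈ initialPoints n k, ∑ j ∈ initialPoints n k, β (Equiv.swap i j)

variable {β}

theorem jucysMurphy_of_lt {k : ℕ} (hk : k < n) :
    jucysMurphy β k = ∑ j ∈ initialPoints n k, β (Equiv.swap j ⟨k, hk⟩) := by
  rw [jucysMurphy, dif_pos hk]

theorem commute_map_jucysMurphy {k l : ℕ} (hkl : k ≤ l) {g : Equiv.Perm (Fin n)}
    (hg : g ∈ youngSubgroup n k) : Commute (β g) (jucysMurphy β l) := by
  unfold jucysMurphy
  split_ifs with hl
  · rw [Commute, SemiconjBy, Finset.mul_sum, Finset.sum_mul]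
    refine Finset.sum_equiv g (fun i => ?_) (fun i _ => ?_)
    · simp [apply_lt_iff_of_mem_youngSubgroup hg hkl]
    · rw [map_mul_map_swap, mem_youngSubgroup.1 hg ⟨l, hl⟩ hkl]
  · exact Commute.zero_right _

theorem initialPoints_succ {k : ℕ} (hk : k < n) :
    initialPoints n (k + 1) =
      insert ⟨k, hk⟩ (initialPoints n k) := by
  ext j
  simp only [mem_initialPoints, Finset.mem_insert, Fin.ext_iff]
  omega

theorem jucysMurphy_succ {k : ℕ} (hk : k + 1 < n) :
    jucysMurphy β (k + 1) =
      β (Equiv.swap ⟨k, by omega⟩ ⟨k + 1, hk⟩) * jucysMurphy β k *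
        β (Equiv.swap ⟨k, by omega⟩ ⟨k + 1, hk⟩) + β (Equiv.swap ⟨k, by omega⟩ ⟨k + 1, hk⟩) := by
  have hk' : k < n := by omega
  have hnot : (⟨k, hk'⟩ : Fin n) ∉ initialPoints n k := by simp
  rw [jucysMurphy_of_lt hk, initialPoints_succ hk', Finset.sum_insert hnot, add_comm,
    jucysMurphy_of_lt hk', Finset.mul_sum, Finset.sum_mul]
  congr 1
  refine Finset.sum_congr rfl fun j hj => ?_
  rw [mem_initialPoints] at hj
  rw [map_mul_map_swap, Equiv.swap_apply_left, Equiv.swap_apply_of_ne_of_ne, mul_assoc,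
    ← map_mul, Equiv.swap_mul_self, map_one, mul_one]
  · rintro rfl; simp at hj
  · rintro rfl; rw [Fin.val_mk] at hj; omega

/-- The images of the simple transpositions under `β` satisfy, after adding `1`, the
Temperley–Lieb relations. -/
def SatisfiesTL (β : Equiv.Perm (Fin n) →* A) : Prop :=
  ∀ (k : ℕ) (hk : k + 2 < n),
    (1 + β (Equiv.swap ⟨k + 1, by omega⟩ ⟨k + 2, hk⟩)) *
        β (Equiv.swap ⟨k, by omega⟩ ⟨k + 1, by omega⟩) *
      (1 + β (Equiv.swap ⟨k + 1, by omega⟩ ⟨k + 2, hk⟩)) =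
    -(1 + β (Equiv.swap ⟨k + 1, by omega⟩ ⟨k + 2, hk⟩))

variable [Algebra ℚ A] (β)

/-- The image in `A` of the group algebra of the permutations of the first `k` points. -/
def youngAlgebra (k : ℕ) : Subalgebra ℚ A :=
  Algebra.adjoin ℚ (β '' (youngSubgroup n k : Set (Equiv.Perm (Fin n))))

variable {β}

theorem map_mem_youngAlgebra {k : ℕ} {g : Equiv.Perm (Fin n)} (hg : g ∈ youngSubgroup n k) :
    β g ∈ youngAlgebra β k :=
  Algebra.subset_adjoin ⟨g, hg, rfl⟩

theorem youngAlgebra_mono {k l : ℕ} (h : k ≤ l) : youngAlgebra β k ≤ youngAlgebra β l :=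
  Algebra.adjoin_mono (Set.image_mono (youngSubgroup_mono h))

theorem youngAlgebra_induction {k : ℕ} {N : Submodule ℚ A}
    (h : ∀ g ∈ youngSubgroup n k, β g ∈ N) {x : A} (hx : x ∈ youngAlgebra β k) : x ∈ N := by
  rw [youngAlgebra, ← Subalgebra.mem_toSubmodule, Algebra.adjoin_eq_span] at hx
  have hcl : Submonoid.closure (β '' (youngSubgroup n k : Set (Equiv.Perm (Fin n)))) ≤
      (youngSubgroup n k).toSubmonoid.map β := by
    rw [Submonoid.closure_le]
    rintro _ ⟨g, hg, rfl⟩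
    exact ⟨g, hg, rfl⟩
  refine Submodule.span_le.2 ?_ hx
  intro y hy
  obtain ⟨g, hg, rfl⟩ := hcl hy
  exact h g hg

theorem commute_of_mem_youngAlgebra {k : ℕ} {z : A}
    (h : ∀ g ∈ youngSubgroup n k, Commute (β g) z) {x : A} (hx : x ∈ youngAlgebra β k) :
    Commute x z := by
  have hle : youngAlgebra β k ≤ Subalgebra.centralizer ℚ {z} := by
    refine Algebra.adjoin_le ?_
    rintro _ ⟨g, hg, rfl⟩
    rw [SetLike.mem_coe, Subalgebra.mem_centralizer_iff]
    rintro _ rfl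
    exact (h g hg).eq.symm
  have := hle hx
  simp only [Subalgebra.mem_centralizer_iff, Set.mem_singleton_iff, forall_eq] at this
  exact this.symm

theorem commute_jucysMurphy_of_mem {k l : ℕ} (hkl : k ≤ l) {x : A} (hx : x ∈ youngAlgebra β k) :
    Commute x (jucysMurphy β l) :=
  commute_of_mem_youngAlgebra (fun _ hg => commute_map_jucysMurphy hkl hg) hx

theorem jucysMurphy_mem {j k : ℕ} (h : j < k) : jucysMurphy β j ∈ youngAlgebra β k := by
  unfold jucysMurphy
  split_ifs with hj
  · refine sum_mem fun i hi => map_mem_youngAlgebra ?_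
    rw [mem_initialPoints] at hi
    exact swap_mem_youngSubgroup (hi.trans h) h
  · exact zero_mem _

theorem commute_jucysMurphy (i j : ℕ) : Commute (jucysMurphy β i) (jucysMurphy β j) := by
  rcases lt_trichotomy i j with h | rfl | h
  · exact commute_jucysMurphy_of_mem le_rfl (jucysMurphy_mem h)
  · exact Commute.refl _
  · exact (commute_jucysMurphy_of_mem le_rfl (jucysMurphy_mem h)).symm

theorem commute_swap_of_mem {k : ℕ} {i j : Fin n} (hi : k ≤ (i : ℕ)) (hj : k ≤ (j : ℕ)) {x : A}
    (hx : x ∈ youngAlgebra β k) : Commute x (β (Equiv.swap i j)) := by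
  refine commute_of_mem_youngAlgebra (fun g hg => ?_) hx
  rw [Commute, SemiconjBy, map_mul_map_swap, mem_youngSubgroup.1 hg i hi,
    mem_youngSubgroup.1 hg j hj]

theorem commute_swapSum_of_mem {k : ℕ} {x : A} (hx : x ∈ youngAlgebra β k) :
    Commute x (swapSum β k) := by
  refine commute_of_mem_youngAlgebra (fun g hg => ?_) hx
  rw [Commute, SemiconjBy, swapSum, Finset.mul_sum, Finset.sum_mul]
  refine Finset.sum_equiv g (fun i => ?_) (fun i _ => ?_)
  · simp [apply_lt_iff_of_mem_youngSubgroup hg le_rfl]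
  · rw [Finset.mul_sum, Finset.sum_mul]
    refine Finset.sum_equiv g (fun i => ?_) (fun j _ => map_mul_map_swap β g i j)
    simp [apply_lt_iff_of_mem_youngSubgroup hg le_rfl]

theorem swapSum_succ {k : ℕ} (hk : k < n) :
    swapSum β (k + 1) = swapSum β k + (2 : ℚ) • jucysMurphy β k + 1 := by
  have hnot : (⟨k, hk⟩ : Fin n) ∉ initialPoints n k := by simp
  rw [swapSum, initialPoints_succ hk, Finset.sum_insert hnot, Finset.sum_insert hnot]
  simp only [Finset.sum_insert hnot, Finset.sum_add_distrib, Equiv.swap_self]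
  rw [← jucysMurphy_of_lt hk, ← swapSum, two_smul]
  simp only [Equiv.swap_comm (⟨k, hk⟩ : Fin n)]
  rw [← jucysMurphy_of_lt hk, ← Equiv.Perm.one_def, map_one]
  abel

theorem SatisfiesTL.cap_jucysMurphy_cap (hβ : SatisfiesTL β) {k : ℕ} (hk : k + 1 < n) :
    (1 + β (Equiv.swap ⟨k, by omega⟩ ⟨k + 1, hk⟩)) * jucysMurphy β k *
      (1 + β (Equiv.swap ⟨k, by omega⟩ ⟨k + 1, hk⟩)) =
    (-(k : ℚ)) • (1 + β (Equiv.swap ⟨k, by omega⟩ ⟨k + 1, hk⟩)) := by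
  have hk' : k < n := by omega
  set u := 1 + β (Equiv.swap ⟨k, hk'⟩ ⟨k + 1, hk⟩) with hu
  have key : ∀ j : Fin n, (j : ℕ) < k → u * β (Equiv.swap j ⟨k, hk'⟩) * u = -u := by
    intro j hj
    obtain ⟨l, rfl⟩ : ∃ l, k = l + 1 := ⟨k - 1, by omega⟩
    have hl : l < n := by omega
    set y := β (Equiv.swap j ⟨l, hl⟩) with hy
    have hyy : y * y = 1 := by rw [hy, ← map_mul, Equiv.swap_mul_self, map_one]
    have hyu : Commute y u := (Commute.one_right _).add_right <|
      commute_swap_of_mem (k := l + 1) le_rfl (by simp)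
        (map_mem_youngAlgebra (swap_mem_youngSubgroup hj (by simp)))
    have hconj : β (Equiv.swap j ⟨l + 1, hk'⟩) =
        y * β (Equiv.swap ⟨l, hl⟩ ⟨l + 1, hk'⟩) * y := by
      rw [map_mul_map_swap, Equiv.swap_apply_right, Equiv.swap_apply_of_ne_of_ne, mul_assoc,
        hyy, mul_one]
      · rintro rfl; simp at hj
      · simp
    have h0 := hβ l hk
    rw [← hu] at h0
    calc u * β (Equiv.swap j ⟨l + 1, hk'⟩) * u
        = y * (u * β (Equiv.swap ⟨l, hl⟩ ⟨l + 1, hk'⟩) * u) * y := by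
          rw [hconj]
          simp only [mul_assoc]
          rw [hyu.eq, ← mul_assoc u y, ← hyu.eq, mul_assoc]
      _ = -u := by rw [h0, mul_neg, neg_mul, hyu.eq, mul_assoc, hyy, mul_one]
  rw [jucysMurphy_of_lt hk', Finset.mul_sum, Finset.sum_mul,
    Finset.sum_congr rfl fun j hj => key j (by simpa using hj), Finset.sum_const, smul_neg,
    neg_smul]
  congr 1
  rw [← Nat.cast_smul_eq_nsmul ℚ, card_initialPoints hk'.le]

theorem jucysMurphy_step_relations {e L M s : A} {c κ : ℚ} (hMe : M * e = c • e)
    (heM : e * M = c • e) (hee : e * e = e) (hLe : L * e = e * L) (hs : s * s = 1)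
    (hL : L = s * M * s + s) (hu : (1 + s) * M * (1 + s) = (-κ) • (1 + s)) :
    L * (e * s * e) = c • (e * s * e) + e ∧
      L * (L * e) = (-κ) • (L * e) + ((c - 1) * (c + κ - 1)) • e := by
  have hLs : L * s = s * M + 1 := by
    rw [hL, add_mul, mul_assoc _ s s, hs, mul_one]
  have hx : L * (e * s * e) = c • (e * s * e) + e := by
    calc L * (e * s * e) = e * (L * s) * e := by simp only [← mul_assoc]; rw [hLe]
      _ = e * s * (M * e) + e * e := by rw [hLs]; simp only [mul_add, add_mul, mul_assoc, mul_one]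
      _ = _ := by rw [hMe, hee, mul_smul_comm]
  have hLexp : L = (-κ) • (1 + s) - M - M * s - s * M + s := by
    rw [← hu, hL]; noncomm_ring
  have hLe2 : L * e = (-κ - c) • e + (1 - κ - 2 * c) • (e * s * e) := by
    have h1 : e * (M * e) = c • e := by rw [hMe, mul_smul_comm, hee]
    have h2 : e * (M * s * e) = c • (e * s * e) := by
      rw [← mul_assoc, ← mul_assoc, heM, smul_mul_assoc, smul_mul_assoc]
    have h3 : e * (s * M * e) = c • (e * s * e) := by
      rw [mul_assoc s, hMe, mul_smul_comm, mul_smul_comm, mul_assoc]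
    calc L * e = e * (L * e) := by rw [← mul_assoc, ← hLe, mul_assoc, hee]
      _ = (-κ) • (e * e + e * s * e) - e * (M * e) - e * (M * s * e) - e * (s * M * e)
            + e * s * e := by
          conv_lhs => rw [hLexp]
          simp only [mul_add, add_mul, mul_sub, sub_mul, smul_mul_assoc, mul_smul_comm, smul_add,
            one_mul, mul_assoc]
      _ = _ := by rw [h1, h2, h3, hee]; module
  refine ⟨hx, ?_⟩
  calc L * (L * e) = (-κ - c) • (L * e) + (1 - κ - 2 * c) • (L * (e * s * e)) := by
        conv_lhs => rw [hLe2]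
        rw [mul_add, mul_smul_comm, mul_smul_comm]
    _ = _ := by rw [hx, hLe2]; module

theorem cap_mul_eq_zero {v L M s : A} {c κ : ℚ} (hM : M * v = c • v) (hL' : L * v = (c - 1) • v)
    (hs : s * s = 1) (hL : L = s * M * s + s) (hu : (1 + s) * M * (1 + s) = (-κ) • (1 + s))
    (hc : 2 * c + κ ≠ 2) : (1 + s) * v = 0 := by
  have hMs : M * s = s * L - 1 := by
    rw [hL, mul_add, ← mul_assoc, ← mul_assoc, hs]; noncomm_ring
  have hLexp : L = (-κ) • (1 + s) - M - M * s - s * M + s := by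
    rw [← hu, hL]; noncomm_ring
  have h1 : M * (s * v) = (c - 1) • (s * v) - v := by
    rw [← mul_assoc, hMs, sub_mul, mul_assoc, hL', mul_smul_comm, one_mul]
  have h2 : (c - 1) • v = (-κ) • (v + s * v) - c • v - ((c - 1) • (s * v) - v) - c • (s * v)
      + s * v := by
    rw [← hL', hLexp]
    simp only [add_mul, sub_mul, smul_mul_assoc, one_mul, mul_assoc, h1, hM, mul_smul_comm]
  have h3 : (2 * c + κ - 2) • ((1 + s) * v) = 0 := by
    rw [add_mul, one_mul]
    rw [← sub_eq_zero.2 h2]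
    module
  exact (smul_eq_zero.1 h3).resolve_left (sub_ne_zero.2 hc)

/-- The content of the entry `k` (counted from `0`) of the tableau with column word `w`. -/
def wordContent (w : ℕ → Fin 2) (k : ℕ) : ℚ :=
  if w k = 0 then -(Nat.count (w · = 0) k : ℚ) else 1 - (Nat.count (w · = 1) k : ℚ)

/-- The content which the entry `k` would have if it were placed in the other column. -/
def otherContent (w : ℕ → Fin 2) (k : ℕ) : ℚ :=
  if w k = 0 then 1 - (Nat.count (w · = 1) k : ℚ) else -(Nat.count (w · = 0) k : ℚ)

/-- The ballot condition for the first `k` letters of a column word. -/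
def IsBallot (w : ℕ → Fin 2) (k : ℕ) : Prop :=
  ∀ m ≤ k, Nat.count (w · = 1) m ≤ Nat.count (w · = 0) m

theorem IsBallot.mono {w : ℕ → Fin 2} {k l : ℕ} (h : IsBallot w l) (hkl : k ≤ l) : IsBallot w k :=
  fun m hm => h m (hm.trans hkl)

theorem IsBallot.count_le {w : ℕ → Fin 2} {k : ℕ} (h : IsBallot w k) :
    Nat.count (w · = 1) k ≤ Nat.count (w · = 0) k :=
  h k le_rfl

theorem count_add_count (w : ℕ → Fin 2) (k : ℕ) :
    Nat.count (w · = 0) k + Nat.count (w · = 1) k = k := by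
  induction k with
  | zero => simp
  | succ k ih =>
    rw [Nat.count_succ, Nat.count_succ]
    obtain h | h : w k = 0 ∨ w k = 1 := by omega
    all_goals simp only [h]; simp; omega

theorem count_congr {w w' : ℕ → Fin 2} {k : ℕ} (h : ∀ j < k, w j = w' j) (c : Fin 2) :
    Nat.count (w · = c) k = Nat.count (w' · = c) k := by
  induction k with
  | zero => simp
  | succ k ih => simp [Nat.count_succ, ih fun j hj => h j (by omega), h k (by omega)]

theorem isBallot_congr {w w' : ℕ → Fin 2} {k : ℕ} (h : ∀ j < k, w j = w' j) :
    IsBallot w k ↔ IsBallot w' k :=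
  forall₂_congr fun m hm => by
    rw [count_congr (fun j hj => h j (by omega)) 0, count_congr (fun j hj => h j (by omega)) 1]

theorem wordContent_congr {w w' : ℕ → Fin 2} {k : ℕ} (h : ∀ j < k, w j = w' j)
    (hk : w k = w' k) : wordContent w k = wordContent w' k := by
  rw [wordContent, wordContent, hk, count_congr h, count_congr h]

theorem otherContent_eq_wordContent {w w' : ℕ → Fin 2} {k : ℕ} (h : ∀ j < k, w j = w' j)
    (hk : w k ≠ w' k) : otherContent w k = wordContent w' k := by
  rw [wordContent, otherContent, count_congr h, count_congr h]
  obtain h0 | h0 : w k = 0 ∨ w k = 1 := by omega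
  · have : w' k = 1 := by omega
    simp [h0, this]
  · have : w' k = 0 := by omega
    simp [h0, this]

theorem wordContent_ne_otherContent {w : ℕ → Fin 2} {k : ℕ} (h : IsBallot w k) :
    wordContent w k ≠ otherContent w k := by
  have h1 : (Nat.count (w · = 1) k : ℚ) ≤ Nat.count (w · = 0) k := by exact_mod_cast h.count_le
  unfold wordContent otherContent
  split_ifs
  · exact ne_of_lt (by linarith)
  · exact ne_of_gt (by linarith)

theorem exists_wordContent_ne {w w' : ℕ → Fin 2} {k : ℕ} (hw : IsBallot w k)
    (hne : ¬ ∀ j < k, w j = w' j) : ∃ j < k, wordContent w j ≠ wordContent w' j := by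
  classical
  push Not at hne
  have hmin : ∀ j < Nat.find hne, w j = w' j := fun j hj => by
    have := Nat.find_min hne hj
    push Not at this
    exact this (hj.trans (Nat.find_spec hne).1)
  obtain ⟨hlt, hj⟩ := Nat.find_spec hne
  refine ⟨_, hlt, ?_⟩
  rw [← otherContent_eq_wordContent hmin hj]
  exact wordContent_ne_otherContent (hw.mono hlt.le)

theorem update_agree (w : ℕ → Fin 2) (k : ℕ) (c : Fin 2) :
    ∀ i < k, Function.update w k c i = w i :=
  fun _ hi => Function.update_of_ne hi.ne _ _

theorem isBallot_succ {w : ℕ → Fin 2} {k : ℕ} :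
    IsBallot w (k + 1) ↔ IsBallot w k ∧
      Nat.count (w · = 1) (k + 1) ≤ Nat.count (w · = 0) (k + 1) := by
  refine ⟨fun h => ⟨h.mono (by omega), h.count_le⟩, fun h m hm => ?_⟩
  rcases hm.eq_or_lt with rfl | hm
  · exact h.2
  · exact h.1 m (by omega)

theorem IsBallot.update_zero {w : ℕ → Fin 2} {k : ℕ} (h : IsBallot w k) :
    IsBallot (Function.update w k 0) (k + 1) := by
  refine isBallot_succ.2 ⟨(isBallot_congr (update_agree w k 0)).2 h, ?_⟩
  have := h.count_le
  rw [Nat.count_succ, Nat.count_succ, count_congr (update_agree w k 0),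
    count_congr (update_agree w k 0)]
  simp; omega

theorem IsBallot.update_one {w : ℕ → Fin 2} {k : ℕ} (h : IsBallot w k)
    (hlt : Nat.count (w · = 1) k < Nat.count (w · = 0) k) :
    IsBallot (Function.update w k 1) (k + 1) := by
  refine isBallot_succ.2 ⟨(isBallot_congr (update_agree w k 1)).2 h, ?_⟩
  rw [Nat.count_succ, Nat.count_succ, count_congr (update_agree w k 1),
    count_congr (update_agree w k 1)]
  simp; omega

variable (β)

/-- The seminormal element attached to the first `k` letters of a column word. -/
def seminormal (w : ℕ → Fin 2) : ℕ → A
  | 0 => 1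
  | k + 1 => seminormal w k * ((wordContent w k - otherContent w k)⁻¹ •
      (jucysMurphy β k - otherContent w k • 1))

/-- The seminormal elements of size `k` are joint eigenvectors of the Jucys–Murphy elements. -/
def SeminormalSpec (k : ℕ) : Prop :=
  ∀ w, IsBallot w k → ∀ j < k,
    jucysMurphy β j * seminormal β w k = wordContent w j • seminormal β w k

/-- The seminormal elements of size `k` resolve the identity. -/
def SeminormalComplete (k : ℕ) : Prop :=
  ∀ (N : Submodule ℚ A) (x y : A), (∀ r, IsBallot r k → x * seminormal β r k * y ∈ N) → x * y ∈ N

/-- The scalar by which `swapSum β k` acts on the seminormal element of a column word. -/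
def wordSwapSum (w : ℕ → Fin 2) : ℕ → ℚ
  | 0 => 0
  | k + 1 => wordSwapSum w k + 2 * wordContent w k + 1

variable {β}

theorem seminormal_succ (w : ℕ → Fin 2) (k : ℕ) :
    seminormal β w (k + 1) = seminormal β w k *
      ((wordContent w k - otherContent w k)⁻¹ • (jucysMurphy β k - otherContent w k • 1)) :=
  rfl

theorem seminormal_congr {w w' : ℕ → Fin 2} {k : ℕ} (h : ∀ j < k, w j = w' j) :
    seminormal β w k = seminormal β w' k := by
  induction k with
  | zero => rfl
  | succ k ih =>
    have h' : ∀ j < k, w j = w' j := fun j hj => h j (by omega)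
    rw [seminormal_succ, seminormal_succ, ih h', wordContent_congr h' (h k (by omega)),
      otherContent, otherContent, h k (by omega), count_congr h', count_congr h']

theorem seminormal_mem (w : ℕ → Fin 2) (k : ℕ) : seminormal β w k ∈ youngAlgebra β k := by
  induction k with
  | zero => exact one_mem _
  | succ k ih =>
    exact mul_mem (youngAlgebra_mono (by omega) ih) <| Subalgebra.smul_mem _
      (sub_mem (jucysMurphy_mem (by omega)) (Subalgebra.smul_mem _ (one_mem _) _)) _

theorem commute_seminormal_jucysMurphy (w : ℕ → Fin 2) (k l : ℕ) :
    Commute (seminormal β w k) (jucysMurphy β l) := by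
  induction k with
  | zero => exact Commute.one_left _
  | succ k ih =>
    exact ih.mul_left <| Commute.smul_left ((commute_jucysMurphy k l).sub_left
      ((Commute.one_left _).smul_left _)) _

theorem commute_seminormal (w w' : ℕ → Fin 2) (k l : ℕ) :
    Commute (seminormal β w k) (seminormal β w' l) := by
  induction l with
  | zero => exact Commute.one_right _
  | succ l ih =>
    exact ih.mul_right <| Commute.smul_right ((commute_seminormal_jucysMurphy w k l).sub_right
      ((Commute.one_right _).smul_right _)) _

theorem SeminormalSpec.mul_jucysMurphy {k : ℕ} (hS : SeminormalSpec β k) {w : ℕ → Fin 2}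
    (hw : IsBallot w k) {j : ℕ} (hj : j < k) :
    seminormal β w k * jucysMurphy β j = wordContent w j • seminormal β w k := by
  rw [(commute_seminormal_jucysMurphy w k j).eq, hS w hw j hj]

theorem SeminormalSpec.seminormal_mul {k : ℕ} (hS : SeminormalSpec β k) {w : ℕ → Fin 2}
    (hw : IsBallot w k) {j : ℕ} (hj : j ≤ k) :
    seminormal β w j * seminormal β w k = seminormal β w k := by
  induction j with
  | zero => exact one_mul _
  | succ j ih =>
    have hne := sub_ne_zero.2 (wordContent_ne_otherContent (hw.mono (show j ≤ k by omega)))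
    rw [seminormal_succ, mul_assoc, smul_mul_assoc, sub_mul, hS w hw j hj, smul_mul_assoc, one_mul,
      ← sub_smul, smul_smul, inv_mul_cancel₀ hne, one_smul, ih (by omega)]

theorem SeminormalSpec.mul_seminormal {k : ℕ} (hS : SeminormalSpec β k) {w : ℕ → Fin 2}
    (hw : IsBallot w k) {j : ℕ} (hj : j ≤ k) :
    seminormal β w k * seminormal β w j = seminormal β w k := by
  rw [(commute_seminormal w w k j).eq, hS.seminormal_mul hw hj]

theorem SeminormalSpec.swapSum_mul {k : ℕ} (hS : SeminormalSpec β k) (hk : k ≤ n) {w : ℕ → Fin 2}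
    (hw : IsBallot w k) {j : ℕ} (hj : j ≤ k) :
    swapSum β j * seminormal β w k = wordSwapSum w j • seminormal β w k := by
  induction j with
  | zero => simp [swapSum, initialPoints, wordSwapSum]
  | succ j ih =>
    rw [swapSum_succ (by omega), add_mul, add_mul, ih (by omega), smul_mul_assoc,
      hS w hw j (by omega), one_mul, wordSwapSum]
    module

theorem wordSwapSum_eq (w : ℕ → Fin 2) (k : ℕ) :
    wordSwapSum w k = 2 * (Nat.count (w · = 0) k : ℚ) - (Nat.count (w · = 0) k : ℚ) ^ 2 +
      4 * (Nat.count (w · = 1) k : ℚ) - (Nat.count (w · = 1) k : ℚ) ^ 2 := by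
  induction k with
  | zero => simp [wordSwapSum]
  | succ k ih =>
    rw [wordSwapSum, ih, Nat.count_succ, Nat.count_succ, wordContent]
    obtain h | h : w k = 0 ∨ w k = 1 := by omega
    all_goals simp [h]; ring

theorem wordSwapSum_ne {w w' : ℕ → Fin 2} {k : ℕ} (hw : IsBallot w k) (hw' : IsBallot w' k)
    (h : Nat.count (w · = 0) k ≠ Nat.count (w' · = 0) k) : wordSwapSum w k ≠ wordSwapSum w' k := by
  have h1 := count_add_count w k
  have h2 := count_add_count w' k
  have h3 := hw.count_le
  have h4 := hw'.count_le
  rw [wordSwapSum_eq, wordSwapSum_eq]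
  generalize Nat.count (w · = 0) k = a at *
  generalize Nat.count (w · = 1) k = b at *
  generalize Nat.count (w' · = 0) k = a' at *
  generalize Nat.count (w' · = 1) k = b' at *
  intro heq
  have e1 : (b : ℚ) = k - a := by rw [← h1]; push_cast; ring
  have e2 : (b' : ℚ) = k - a' := by rw [← h2]; push_cast; ring
  have h5 : (k : ℚ) ≤ 2 * a := by exact_mod_cast (by omega : k ≤ 2 * a)
  have h6 : (k : ℚ) ≤ 2 * a' := by exact_mod_cast (by omega : k ≤ 2 * a')
  have hne : (a : ℚ) - a' ≠ 0 := sub_ne_zero.2 (by exact_mod_cast h)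
  have : ((a : ℚ) - a') * (a + a' + 1 - k) = 0 := by
    rw [e1, e2] at heq
    linear_combination (-1 / 2) * heq
  rcases mul_eq_zero.1 this with h | h
  · exact hne h
  · linarith

theorem SeminormalSpec.mul_mul_eq_zero {k : ℕ} (hS : SeminormalSpec β k) (hk : k ≤ n)
    {w w' : ℕ → Fin 2} (hw : IsBallot w k) (hw' : IsBallot w' k)
    (h : Nat.count (w · = 0) k ≠ Nat.count (w' · = 0) k) {x : A} (hx : x ∈ youngAlgebra β k) :
    seminormal β w k * x * seminormal β w' k = 0 := by
  have h1 : seminormal β w k * x * (swapSum β k * seminormal β w' k) =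
      wordSwapSum w k • (seminormal β w k * x * seminormal β w' k) := by
    have hc : Commute (seminormal β w k * x) (swapSum β k) :=
      commute_swapSum_of_mem (mul_mem (seminormal_mem w k) hx)
    rw [← mul_assoc, hc.eq, ← mul_assoc, hS.swapSum_mul hk hw le_rfl]
    simp only [smul_mul_assoc]
  rw [hS.swapSum_mul hk hw' le_rfl, mul_smul_comm, ← sub_eq_zero, ← sub_smul] at h1
  exact (smul_eq_zero.1 h1).resolve_left (sub_ne_zero.2 (wordSwapSum_ne hw hw' h).symm)

theorem SeminormalSpec.mul_swap_mul (hβ : SatisfiesTL β) {k : ℕ} (hS : SeminormalSpec β (k + 1))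
    (hk : k + 1 < n) {w : ℕ → Fin 2} (hw : IsBallot w (k + 1)) :
    jucysMurphy β (k + 1) * (seminormal β w (k + 1) *
        β (Equiv.swap ⟨k, by omega⟩ ⟨k + 1, hk⟩) * seminormal β w (k + 1)) =
      wordContent w k • (seminormal β w (k + 1) *
        β (Equiv.swap ⟨k, by omega⟩ ⟨k + 1, hk⟩) * seminormal β w (k + 1)) +
          seminormal β w (k + 1) ∧
    jucysMurphy β (k + 1) * (jucysMurphy β (k + 1) * seminormal β w (k + 1)) =
      (-(k : ℚ)) • (jucysMurphy β (k + 1) * seminormal β w (k + 1)) +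
        ((wordContent w k - 1) * (wordContent w k + k - 1)) • seminormal β w (k + 1) := by
  refine jucysMurphy_step_relations (hS w hw k (by omega)) (hS.mul_jucysMurphy hw (by omega))
    (hS.seminormal_mul hw le_rfl) (commute_seminormal_jucysMurphy _ _ _).eq.symm ?_
    (jucysMurphy_succ hk) (hβ.cap_jucysMurphy_cap hk)
  rw [← map_mul, Equiv.swap_mul_self, map_one]

theorem SeminormalSpec.jucysMurphy_quadratic (hβ : SatisfiesTL β) {k : ℕ}
    (hS : SeminormalSpec β k) (hk : k < n) {w : ℕ → Fin 2} (hw : IsBallot w k) :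
    jucysMurphy β k * (jucysMurphy β k * seminormal β w k) =
      (wordContent w k + otherContent w k) • (jucysMurphy β k * seminormal β w k) -
        (wordContent w k * otherContent w k) • seminormal β w k := by
  cases k with
  | zero =>
    have h0 : jucysMurphy β 0 = 0 := by simp [jucysMurphy, initialPoints]
    have : wordContent w 0 * otherContent w 0 = 0 := by
      simp [wordContent, otherContent]
    simp [h0, this]
  | succ k =>
    have h := congrArg (Nat.cast (R := ℚ)) (count_add_count w k)
    push_cast at h
    have h1 : wordContent w (k + 1) + otherContent w (k + 1) = -k := by
      have h' := congrArg (Nat.cast (R := ℚ)) (count_add_count w (k + 1))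
      push_cast at h'
      unfold wordContent otherContent
      split_ifs <;> linarith
    have h2 : wordContent w (k + 1) * otherContent w (k + 1) =
        -(Nat.count (w · = 0) (k + 1)) * (1 - Nat.count (w · = 1) (k + 1)) := by
      unfold wordContent otherContent
      split_ifs <;> ring
    have h3 : (wordContent w k - 1) * (wordContent w k + k - 1) =
        (Nat.count (w · = 0) (k + 1)) * (1 - Nat.count (w · = 1) (k + 1)) := by
      rw [Nat.count_succ, Nat.count_succ, wordContent]
      obtain h0 | h0 : w k = 0 ∨ w k = 1 := by omega
      all_goals simp [h0]; rw [← h]; ring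
    rw [(hS.mul_swap_mul hβ hk hw).2, h1, h2, h3]
    module

theorem SeminormalSpec.succ (hβ : SatisfiesTL β) {k : ℕ}
    (hS : SeminormalSpec β k) (hk : k < n) : SeminormalSpec β (k + 1) := by
  intro w hw j hj
  have hw' := hw.mono (show k ≤ k + 1 by omega)
  rcases (Nat.lt_succ_iff.1 hj).eq_or_lt with rfl | hj
  · rw [seminormal_succ, mul_smul_comm, mul_smul_comm, smul_comm (wordContent w j)]
    congr 1
    rw [mul_sub, mul_sub, mul_smul_comm, mul_one, mul_smul_comm,
      (commute_seminormal_jucysMurphy w j j).eq, hS.jucysMurphy_quadratic hβ hk hw']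
    module
  · rw [seminormal_succ, ← mul_assoc, hS w hw' j hj, smul_mul_assoc]

theorem SeminormalSpec.jucysMurphy_mul_of_count_eq (hβ : SatisfiesTL β) {k : ℕ}
    (hS : SeminormalSpec β k) (hC : SeminormalComplete β k) (hk : k < n) {w : ℕ → Fin 2}
    (hw : IsBallot w k) (heq : Nat.count (w · = 0) k = Nat.count (w · = 1) k) :
    jucysMurphy β k * seminormal β w k =
      (-(Nat.count (w · = 0) k : ℚ)) • seminormal β w k := by
  cases k with
  | zero => simp [jucysMurphy, initialPoints]
  | succ k =>
    set L := jucysMurphy β (k + 1) with hL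
    set e := seminormal β w (k + 1) with he
    set s := β (Equiv.swap ⟨k, by omega⟩ ⟨k + 1, hk⟩) with hs
    set a := Nat.count (w · = 0) (k + 1) with ha
    have hka : a + a = k + 1 := by
      conv_rhs => rw [← count_add_count w (k + 1)]
      omega
    have hss : s * s = 1 := by rw [hs, ← map_mul, Equiv.swap_mul_self, map_one]
    set p := L * e + (a : ℚ) • e with hp
    have hLp : L * p = (1 - (a : ℚ)) • p := by
      have hsum : wordContent w (k + 1) + otherContent w (k + 1) = 1 - a - a := by
        unfold wordContent otherContent
        split_ifs <;> rw [← heq] <;> ring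
      have hprod : wordContent w (k + 1) * otherContent w (k + 1) = -a * (1 - a) := by
        unfold wordContent otherContent
        split_ifs
        · rw [← heq]
        · rw [← heq]
          ring
      rw [hp, mul_add, mul_smul_comm, hS.jucysMurphy_quadratic hβ hk hw, hsum, hprod]
      module
    have hcap : ∀ y ∈ youngAlgebra β (k + 1), (1 + s) * (y * p) = 0 := by
      intro y hy
      rw [← Submodule.mem_bot ℚ]
      refine hC ⊥ _ _ fun r hr => ?_
      rw [Submodule.mem_bot, mul_assoc]
      by_cases hra : Nat.count (r · = 0) (k + 1) = a
      · have hk1 := count_add_count r (k + 1)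
        have hr0 := (hr.mono (show k ≤ k + 1 by omega)).count_le
        have hrk : r k = 1 := by
          by_contra hne
          have h0 : r k = 0 := by omega
          simp [Nat.count_succ, h0] at hra hk1
          omega
        have hc : wordContent r k = 2 - (a : ℚ) := by
          have h1 : Nat.count (r · = 1) (k + 1) = a := by omega
          rw [Nat.count_succ] at h1
          simp [hrk] at h1
          rw [wordContent, if_neg (by simp [hrk]), ← h1]
          push_cast
          ring
        refine cap_mul_eq_zero (M := jucysMurphy β k) (L := L) (c := 2 - a) (κ := k) ?_ ?_ hss
          (jucysMurphy_succ hk) (hβ.cap_jucysMurphy_cap hk) ?_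
        · rw [← mul_assoc, hS r hr k (by omega), smul_mul_assoc, hc]
        · have hcomm : Commute (seminormal β r (k + 1) * y) L :=
            commute_jucysMurphy_of_mem le_rfl (mul_mem (seminormal_mem r _) hy)
          rw [← mul_assoc (seminormal β r (k + 1)), ← mul_assoc, ← hcomm.eq, mul_assoc _ L, hLp,
            mul_smul_comm]
          congr 1
          ring
        · have : (a : ℚ) + a = k + 1 := by exact_mod_cast hka
          intro h
          linarith
      · have h0 := hS.mul_mul_eq_zero hk.le hr hw hra hy
        have hpe : p = e * (L + (a : ℚ) • 1) := by
          rw [hp, mul_add, mul_smul_comm, mul_one, (commute_seminormal_jucysMurphy w _ _).eq]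
        rw [hpe, ← mul_assoc y, ← mul_assoc, ← mul_assoc, ← mul_assoc, mul_assoc (1 + s),
          mul_assoc (1 + s), h0, mul_zero, zero_mul]
    have hswap : ∀ j ∈ initialPoints n (k + 1), β (Equiv.swap j ⟨k + 1, hk⟩) * p = -p := by
      intro j hj
      rw [mem_initialPoints] at hj
      have hk' : k < n := by omega
      set y := β (Equiv.swap j ⟨k, hk'⟩) with hy
      have hyy : y * y = 1 := by rw [hy, ← map_mul, Equiv.swap_mul_self, map_one]
      have hymem : y ∈ youngAlgebra β (k + 1) :=
        map_mem_youngAlgebra (swap_mem_youngSubgroup hj (by simp))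
      have h1 : y * s = β (Equiv.swap j ⟨k + 1, hk⟩) * y := by
        rw [hy, hs, map_mul_map_swap, Equiv.swap_apply_right, Equiv.swap_apply_of_ne_of_ne]
        · rintro rfl; simp at hj
        · simp
      have h2 := hcap y hymem
      rw [add_mul, one_mul] at h2
      calc β (Equiv.swap j ⟨k + 1, hk⟩) * p
          = y * (s * (y * p)) := by
            rw [← mul_assoc y, h1, ← mul_assoc, mul_assoc _ y y, hyy, mul_one]
        _ = -p := by
            rw [eq_neg_of_add_eq_zero_right h2, mul_neg, ← mul_assoc, hyy, one_mul]
    have hLp' : L * p = -((k + 1 : ℕ) : ℚ) • p := by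
      rw [hL, jucysMurphy_of_lt hk, Finset.sum_mul, Finset.sum_congr rfl hswap, Finset.sum_const,
        card_initialPoints hk.le, smul_neg, neg_smul, Nat.cast_smul_eq_nsmul]
    have h0 : ((a : ℚ) + 1) • p = 0 := by
      rw [← hka, hLp] at hLp'
      push_cast at hLp'
      rw [← sub_eq_zero.2 hLp']
      module
    have hp0 : p = 0 := (smul_eq_zero.1 h0).resolve_left (by positivity)
    rw [neg_smul]
    exact eq_neg_of_add_eq_zero_left hp0

theorem SeminormalComplete.succ (hβ : SatisfiesTL β) {k : ℕ} (hS : SeminormalSpec β k)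
    (hC : SeminormalComplete β k) (hk : k < n) : SeminormalComplete β (k + 1) := by
  intro N x y h
  refine hC N x y fun r hr => ?_
  have h0 := h _ hr.update_zero
  have e0 : seminormal β (Function.update r k 0) (k + 1) = seminormal β r k *
      ((-(Nat.count (r · = 0) k : ℚ) - (1 - (Nat.count (r · = 1) k : ℚ)))⁻¹ •
        (jucysMurphy β k - (1 - (Nat.count (r · = 1) k : ℚ)) • 1)) := by
    rw [seminormal_succ, seminormal_congr (update_agree r k 0), wordContent, otherContent,
      count_congr (update_agree r k 0), count_congr (update_agree r k 0)]
    simp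
  have hle : (Nat.count (r · = 1) k : ℚ) ≤ Nat.count (r · = 0) k := by exact_mod_cast hr.count_le
  have hne : -(Nat.count (r · = 0) k : ℚ) - (1 - (Nat.count (r · = 1) k : ℚ)) ≠ 0 := by linarith
  rcases hr.count_le.eq_or_lt with heq | hlt
  · have : seminormal β (Function.update r k 0) (k + 1) = seminormal β r k := by
      rw [e0, mul_smul_comm, mul_sub, (commute_seminormal_jucysMurphy r k k).eq,
        hS.jucysMurphy_mul_of_count_eq hβ hC hk hr heq.symm, mul_smul_comm, mul_one, ← sub_smul,
        smul_smul, inv_mul_cancel₀ hne, one_smul]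
    rwa [this] at h0
  · have h1 := h _ (hr.update_one hlt)
    have e1 : seminormal β (Function.update r k 1) (k + 1) = seminormal β r k *
        ((1 - (Nat.count (r · = 1) k : ℚ) - -(Nat.count (r · = 0) k : ℚ))⁻¹ •
          (jucysMurphy β k - (-(Nat.count (r · = 0) k : ℚ)) • 1)) := by
      rw [seminormal_succ, seminormal_congr (update_agree r k 1), wordContent, otherContent,
        count_congr (update_agree r k 1), count_congr (update_agree r k 1)]
      simp
    have : seminormal β r k = seminormal β (Function.update r k 0) (k + 1) +
        seminormal β (Function.update r k 1) (k + 1) := by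
      rw [e0, e1, ← mul_add]
      generalize -(Nat.count (r · = 0) k : ℚ) = c at *
      generalize (1 - (Nat.count (r · = 1) k : ℚ)) = d at *
      have hinv : (d - c)⁻¹ = -(c - d)⁻¹ := by rw [← inv_neg, neg_sub]
      have : (c - d)⁻¹ • (jucysMurphy β k - d • 1) + (d - c)⁻¹ • (jucysMurphy β k - c • 1) =
          ((c - d)⁻¹ * (c - d)) • (1 : A) := by
        rw [hinv]; module
      rw [this, inv_mul_cancel₀ hne, one_smul, mul_one]
    rw [this, mul_add, add_mul]
    exact N.add_mem h0 h1

theorem seminormalSpec_and_complete (hβ : SatisfiesTL β) {k : ℕ} (hk : k ≤ n) :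
    SeminormalSpec β k ∧ SeminormalComplete β k := by
  induction k with
  | zero =>
    refine ⟨fun w _ j hj => absurd hj (by omega), fun N x y h => ?_⟩
    simpa [seminormal] using h (fun _ => 0) (by intro m hm; simp [Nat.le_zero.1 hm])
  | succ k ih =>
    obtain ⟨hS, hC⟩ := ih (by omega)
    exact ⟨hS.succ hβ (by omega), hC.succ hβ hS (by omega)⟩

theorem seminormal_mul_mul_mem_span (hβ : SatisfiesTL β) {k : ℕ} (hk : k ≤ n) {w : ℕ → Fin 2}
    (hw : IsBallot w k) {x : A} (hx : x ∈ youngAlgebra β k) :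
    seminormal β w k * x * seminormal β w k ∈ Submodule.span ℚ {seminormal β w k} := by
  induction k generalizing w x with
  | zero =>
    refine youngAlgebra_induction
      (N := (Submodule.span ℚ {seminormal β w 0}).comap (LinearMap.mulLeftRight ℚ (1, 1))) ?_ hx
    intro g hg
    obtain rfl : g = 1 := Equiv.ext fun i => mem_youngSubgroup.1 hg i (Nat.zero_le _)
    simp [seminormal, Submodule.mem_span_singleton_self]
  | succ k ih =>
    obtain ⟨hS, hC⟩ := seminormalSpec_and_complete hβ (show k ≤ n by omega)
    have hS' := hS.succ hβ (show k < n by omega)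
    have hw' := hw.mono (show k ≤ k + 1 by omega)
    set G := seminormal β w (k + 1) with hG
    set N := Submodule.span ℚ {G} with hN
    have hGE : G * seminormal β w k = G := hS'.mul_seminormal hw (by omega)
    have hEG : seminormal β w k * G = G := hS'.seminormal_mul hw (by omega)
    have hGG : G * G = G := hS'.seminormal_mul hw le_rfl
    have hsub : ∀ y ∈ youngAlgebra β k, G * y * G ∈ N := by
      intro y hy
      obtain ⟨c, hc⟩ := Submodule.mem_span_singleton.1 (ih (by omega) hw' hy)
      have : G * y * G = c • G := by
        calc G * y * G = (G * seminormal β w k) * y * (seminormal β w k * G) := by rw [hGE, hEG]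
          _ = G * (seminormal β w k * y * seminormal β w k) * G := by simp only [mul_assoc]
          _ = c • G := by rw [← hc, mul_smul_comm, smul_mul_assoc, hGE, hGG]
      rw [this]
      exact N.smul_mem _ (Submodule.mem_span_singleton_self _)
    refine youngAlgebra_induction (N := N.comap (LinearMap.mulLeftRight ℚ (G, G))) ?_ hx
    intro g hg
    rw [Submodule.mem_comap, LinearMap.mulLeftRight_apply]
    rcases exists_mul_swap_of_mem_youngSubgroup_succ (show k < n by omega) hg with
      hg | ⟨h, hh, j, hj, rfl⟩
    · exact hsub _ (map_mem_youngAlgebra hg)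
    obtain ⟨l, rfl⟩ : ∃ l, k = l + 1 := ⟨k - 1, by omega⟩
    have hl : l < n := by omega
    set y := β (Equiv.swap j ⟨l, hl⟩) with hy
    set s := β (Equiv.swap ⟨l, hl⟩ ⟨l + 1, by omega⟩) with hs
    have hyy : y * y = 1 := by rw [hy, ← map_mul, Equiv.swap_mul_self, map_one]
    have hymem : y ∈ youngAlgebra β (l + 1) :=
      map_mem_youngAlgebra (swap_mem_youngSubgroup hj (by simp))
    have hymem' : β h * y ∈ youngAlgebra β (l + 1) := mul_mem (map_mem_youngAlgebra hh) hymem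
    have hconj : β (Equiv.swap j ⟨l + 1, by omega⟩) = y * s * y := by
      rw [hy, hs, map_mul_map_swap, Equiv.swap_apply_right, Equiv.swap_apply_of_ne_of_ne,
        mul_assoc, ← hy, hyy, mul_one]
      · intro h'; rw [← h'] at hj; simp at hj
      · simp
    have hassoc : G * β (h * Equiv.swap j ⟨l + 1, by omega⟩) * G =
        (G * (β h * y)) * (s * (y * G)) := by
      rw [map_mul, hconj]
      simp only [mul_assoc]
    rw [hassoc]
    refine hC N _ _ fun r hr => ?_
    rw [← mul_assoc]
    refine hC N _ _ fun r' hr' => ?_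
    by_cases h1 : Nat.count (w · = 0) (l + 1) = Nat.count (r · = 0) (l + 1)
    swap
    · have h0 := hS.mul_mul_eq_zero (by omega) hw' hr h1 hymem'
      have : G * (β h * y) * seminormal β r (l + 1) = 0 := by
        rw [← hGE, mul_assoc G, mul_assoc G, h0, mul_zero]
      rw [this, zero_mul, zero_mul, zero_mul]
      exact N.zero_mem
    by_cases h2 : Nat.count (r' · = 0) (l + 1) = Nat.count (w · = 0) (l + 1)
    swap
    · have h0 := hS.mul_mul_eq_zero (by omega) hr' hw' h2 hymem
      have : seminormal β r' (l + 1) * (y * G) = 0 := by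
        rw [← hEG, ← mul_assoc, ← mul_assoc, h0, zero_mul]
      rw [mul_assoc, this, mul_zero]
      exact N.zero_mem
    by_cases hagree : ∀ i < l, r i = r' i
    · have hlast : r l = r' l := by
        rw [← h2, Nat.count_succ, Nat.count_succ, count_congr hagree] at h1
        obtain h3 | h3 : r l = 0 ∨ r l = 1 := by omega
        all_goals
          obtain h4 | h4 : r' l = 0 ∨ r' l = 1 := by omega
          all_goals simp [h3, h4] at h1 ⊢
      have hall : ∀ i < l + 1, r' i = r i := by
        intro i hi
        rcases (Nat.lt_succ_iff.1 hi).eq_or_lt with rfl | hi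
        · exact hlast.symm
        · exact (hagree i hi).symm
      rw [seminormal_congr hall]
      set e := seminormal β r (l + 1) with he
      have hLx := (hS.mul_swap_mul hβ (by omega) hr).1
      rw [← he, ← hs] at hLx
      set L := jucysMurphy β (l + 1)
      have hGL : G * L = wordContent w (l + 1) • G := hS'.mul_jucysMurphy hw (by omega)
      have hcomm : Commute (β h * y) L := commute_jucysMurphy_of_mem le_rfl hymem'
      have hne : wordContent w (l + 1) - wordContent r l ≠ 0 := by
        have hb := hw.count_le
        have hsum1 := count_add_count w (l + 1)
        have hsum2 := count_add_count r (l + 1)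
        have hr1 := hr.count_le
        have h5 : Nat.count (w · = 1) (l + 1) = Nat.count (r · = 1) (l + 1) := by omega
        rw [Nat.count_succ (w · = 0) (l + 1), Nat.count_succ (w · = 1) (l + 1), h1, h5] at hb
        rw [wordContent, wordContent, h1, h5]
        rw [Nat.count_succ, Nat.count_succ] at hb hr1 ⊢
        intro hzero
        obtain h3 | h3 : r l = 0 ∨ r l = 1 := by omega
        all_goals
          obtain h4 | h4 : w (l + 1) = 0 ∨ w (l + 1) = 1 := by omega
          all_goals
            simp [h3, h4] at hb hr1 hzero <;> (try qify at hb hr1) <;> linarith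
      have key : (wordContent w (l + 1) - wordContent r l) •
          (G * (β h * y) * (e * s * e) * (y * G)) = (G * (β h * y * e * y) * G) := by
        have e1 : G * (β h * y) * (L * (e * s * e)) * (y * G) =
            wordContent w (l + 1) • (G * (β h * y) * (e * s * e) * (y * G)) := by
          rw [← mul_assoc _ L, mul_assoc G, hcomm.eq, ← mul_assoc G, hGL]
          simp only [smul_mul_assoc]
        rw [sub_smul, ← e1, hLx]
        simp only [mul_add, add_mul, mul_smul_comm, smul_mul_assoc, mul_assoc]
        abel
      have hmem : (wordContent w (l + 1) - wordContent r l) •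
          (G * (β h * y) * (e * s * e) * (y * G)) ∈ N := by
        rw [key]
        exact hsub _ (mul_mem (mul_mem hymem' (seminormal_mem r _)) hymem)
      have := (N.smul_mem_iff hne).1 hmem
      simpa only [mul_assoc] using this
    · obtain ⟨i, hi, hne⟩ := exists_wordContent_ne (hr.mono (show l ≤ l + 1 by omega)) hagree
      have hcomm : Commute (jucysMurphy β i) s :=
        commute_swap_of_mem le_rfl (by simp) (jucysMurphy_mem hi)
      have h3 : seminormal β r (l + 1) * s * (jucysMurphy β i * seminormal β r' (l + 1)) =
          wordContent r i • (seminormal β r (l + 1) * s * seminormal β r' (l + 1)) := by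
        rw [← mul_assoc, mul_assoc _ s, ← hcomm.eq, ← mul_assoc, hS.mul_jucysMurphy hr (by omega)]
        simp only [smul_mul_assoc]
      rw [hS r' hr' i (by omega), mul_smul_comm, ← sub_eq_zero, ← sub_smul] at h3
      have h4 := (smul_eq_zero.1 h3).resolve_left (sub_ne_zero.2 hne.symm)
      have : G * (β h * y) * seminormal β r (l + 1) * s * seminormal β r' (l + 1) = 0 := by
        rw [mul_assoc _ _ s, mul_assoc, h4, mul_zero]
      rw [this, zero_mul]
      exact N.zero_mem

theorem map_seminormal_pos (τ : A →ₗ[ℚ] ℚ) (h1 : 0 < τ 1)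
    (hτ : ∀ k < n, ∀ x ∈ youngAlgebra β k, τ (x * jucysMurphy β k) = -(k / 2 : ℚ) * τ x)
    {w : ℕ → Fin 2} {k : ℕ} (hk : k ≤ n) (hw : IsBallot w k) : 0 < τ (seminormal β w k) := by
  induction k with
  | zero => exact h1
  | succ k ih =>
    have hpos := ih (by omega) (hw.mono (by omega))
    rw [seminormal_succ, mul_smul_comm, mul_sub, mul_smul_comm, mul_one, map_smul, map_sub,
      hτ k (by omega) _ (seminormal_mem w k), map_smul, smul_eq_mul, smul_eq_mul, ← sub_mul,
      ← mul_assoc]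
    refine mul_pos ?_ hpos
    have hb' := hw.count_le
    rw [Nat.count_succ, Nat.count_succ] at hb'
    have hb : (Nat.count (w · = 1) k : ℚ) ≤ Nat.count (w · = 0) k := by
      exact_mod_cast (hw.mono (show k ≤ k + 1 by omega)).count_le
    have hs : (Nat.count (w · = 0) k : ℚ) + Nat.count (w · = 1) k = k := by
      exact_mod_cast count_add_count w k
    rw [wordContent, otherContent, ← hs]
    split_ifs with h0
    · refine mul_pos_of_neg_of_neg (inv_lt_zero.2 ?_) ?_ <;> linarith
    · have h0' : w k = 1 := by omega
      simp [h0'] at hb'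
      have : (Nat.count (w · = 1) k : ℚ) + 1 ≤ Nat.count (w · = 0) k := by exact_mod_cast hb'
      refine mul_pos (inv_pos.2 ?_) ?_ <;> linarith

theorem list_prod_map_mul_eq_smul {ι : Type*} {l : List ι} {F : ι → A} {f : ι → ℚ} {v : A}
    (h : ∀ i ∈ l, F i * v = f i • v) : (l.map F).prod * v = (l.map f).prod • v := by
  induction l with
  | nil => simp
  | cons i l ih =>
    rw [List.map_cons, List.map_cons, List.prod_cons, List.prod_cons, mul_assoc,
      ih fun j hj => h j (List.mem_cons_of_mem _ hj), mul_smul_comm, h i List.mem_cons_self,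
      smul_smul, mul_comm]

theorem eq_seminormal_of_mul (hβ : SatisfiesTL β) {w : ℕ → Fin 2} {k : ℕ} (hk : k ≤ n)
    (hw : IsBallot w k) {x : A} (hsame : x * seminormal β w k = seminormal β w k)
    (hdiff : ∀ r, IsBallot r k → ∀ j < k, wordContent w j ≠ wordContent r j →
      x * seminormal β r k = 0) : x = seminormal β w k := by
  obtain ⟨hS, hC⟩ := seminormalSpec_and_complete hβ hk
  rw [← sub_eq_zero, ← mul_one (x - _), ← Submodule.mem_bot ℚ]
  refine hC ⊥ _ _ fun r hr => ?_
  rw [Submodule.mem_bot, mul_one, sub_mul]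
  by_cases hagree : ∀ j < k, w j = r j
  · rw [← seminormal_congr hagree, hsame, hS.seminormal_mul hw le_rfl, sub_self]
  · obtain ⟨j, hj, hne⟩ := exists_wordContent_ne hw hagree
    have h3 : seminormal β w k * (jucysMurphy β j * seminormal β r k) =
        wordContent w j • (seminormal β w k * seminormal β r k) := by
      rw [← mul_assoc, hS.mul_jucysMurphy hw hj, smul_mul_assoc]
    rw [hS r hr j hj, mul_smul_comm, ← sub_eq_zero, ← sub_smul] at h3
    rw [hdiff r hr j hj hne, (smul_eq_zero.1 h3).resolve_left (sub_ne_zero.2 hne.symm), sub_zero]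

theorem not_exists_orthogonal_decomposition {E : A} (hE : E * E = E)
    (h : ∀ x, E * x * E ∈ Submodule.span ℚ {E}) :
    ¬ ∃ e e' : A, e ≠ 0 ∧ e' ≠ 0 ∧ IsIdempotentElem e ∧ IsIdempotentElem e' ∧
      e * e' = 0 ∧ e' * e = 0 ∧ E = e + e' := by
  rintro ⟨e, e', he, he', hee, hee', h1, h2, rfl⟩
  obtain ⟨c, hc⟩ := Submodule.mem_span_singleton.1 (h e)
  have h3 : c • (e + e') = e := by
    rw [hc, add_mul, hee.eq, h2, add_zero, mul_add, hee.eq, h1, add_zero]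
  have h4 : c • e' = 0 := by
    have := congrArg (· * e') h3
    simpa [add_mul, h1, hee'.eq] using this
  obtain rfl := (smul_eq_zero.1 h4).resolve_right he'
  rw [zero_smul] at h3
  exact he h3.symm

end TemperleyLiebQuotient

section SymmetricGroup

variable {n : ℕ}

theorem mclosure_range_simpleT (n : ℕ) : Submonoid.closure (Set.range (simpleT n)) = ⊤ := by
  cases n with
  | zero => exact Subsingleton.elim _ _
  | succ n => exact Equiv.Perm.mclosure_swap_castSucc_succ n

/-- The action of permutations by place permutation on functions of `n` boolean variables. -/
def placePerm (n : ℕ) : Equiv.Perm (Fin n) →* Module.End ℚ ((Fin n → Bool) → ℚ) where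
  toFun g := LinearMap.funLeft ℚ ℚ fun w => w ∘ g
  map_one' := rfl
  map_mul' _ _ := rfl

theorem placePerm_apply (g : Equiv.Perm (Fin n)) (f : (Fin n → Bool) → ℚ) (w : Fin n → Bool) :
    placePerm n g f w = f (w ∘ g) :=
  rfl

theorem comp_swap_of_eq {X Y : Type*} [DecidableEq X] {w : X → Y} {a b : X} (h : w a = w b) :
    w ∘ Equiv.swap a b = w := by
  funext i
  rw [Function.comp_apply, Equiv.swap_apply_def]
  split_ifs with h1 h2
  · rw [h1, h]
  · rw [h2, h]
  · rfl

theorem placePerm_antisymmetrizer {a b c : Fin n} (hab : a ≠ b) (hbc : b ≠ c) (hac : a ≠ c) :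
    1 - placePerm n (Equiv.swap a b) - placePerm n (Equiv.swap b c) +
      placePerm n (Equiv.swap a b * Equiv.swap b c) +
      placePerm n (Equiv.swap b c * Equiv.swap a b) - placePerm n (Equiv.swap a c) = 0 := by
  have e1 : Equiv.swap a b * Equiv.swap b c = Equiv.swap a c * Equiv.swap a b := by
    rw [Equiv.mul_swap_eq_swap_mul, Equiv.swap_apply_right,
      Equiv.swap_apply_of_ne_of_ne hac.symm hbc.symm]
  have e2 : Equiv.swap b c * Equiv.swap a b = Equiv.swap a c * Equiv.swap b c := by
    rw [Equiv.mul_swap_eq_swap_mul, Equiv.swap_apply_left, Equiv.swap_apply_of_ne_of_ne hab hac]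
  have e3 : Equiv.swap a b * Equiv.swap a c = Equiv.swap b c * Equiv.swap a b := by
    rw [Equiv.mul_swap_eq_swap_mul, Equiv.swap_apply_left,
      Equiv.swap_apply_of_ne_of_ne hac.symm hbc.symm]
  have e4 : Equiv.swap b c * Equiv.swap a c = Equiv.swap a b * Equiv.swap b c := by
    rw [Equiv.mul_swap_eq_swap_mul, Equiv.swap_apply_right, Equiv.swap_apply_of_ne_of_ne hab hac]
  ext f w
  have hcomp : ∀ g h : Equiv.Perm (Fin n), w ∘ ⇑(g * h) = (w ∘ g) ∘ h := fun _ _ => rfl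
  have hpigeon : w a = w b ∨ w b = w c ∨ w a = w c := by
    cases w a <;> cases w b <;> cases w c <;> simp
  simp only [LinearMap.add_apply, LinearMap.sub_apply, Module.End.one_apply, Pi.add_apply,
    Pi.sub_apply, LinearMap.comp_apply, placePerm_apply, LinearMap.zero_apply, Pi.zero_apply]
  rcases hpigeon with h | h | h
  · rw [← e3, hcomp, hcomp, comp_swap_of_eq h]
    ring
  · rw [← e4, hcomp, hcomp, comp_swap_of_eq h]
    ring
  · rw [e1, e2, hcomp, hcomp, comp_swap_of_eq h]
    ring

theorem one_sub_placePerm_braid {a b c : Fin n} (hab : a ≠ b) (hbc : b ≠ c) (hac : a ≠ c) :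
    (1 - placePerm n (Equiv.swap a b)) * (1 - placePerm n (Equiv.swap b c)) *
      (1 - placePerm n (Equiv.swap a b)) = 1 - placePerm n (Equiv.swap a b) := by
  have h1 : placePerm n (Equiv.swap a b) * placePerm n (Equiv.swap a b) = 1 := by
    rw [← map_mul, Equiv.swap_mul_self, map_one]
  have h2 : placePerm n (Equiv.swap a b) * placePerm n (Equiv.swap b c) *
      placePerm n (Equiv.swap a b) = placePerm n (Equiv.swap a c) := by
    rw [← map_mul, ← map_mul, Equiv.mul_swap_eq_swap_mul _ b c, Equiv.swap_apply_right,
      Equiv.swap_apply_of_ne_of_ne hac.symm hbc.symm, mul_assoc, Equiv.swap_mul_self, mul_one]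
  have h3 := placePerm_antisymmetrizer hab hbc hac
  rw [map_mul, map_mul, ← h2] at h3
  rw [← sub_eq_zero, ← h3]
  simp only [mul_sub, sub_mul, mul_one, one_mul, h1]
  abel

theorem two_mul_card_fixed_mul_swap {X : Type*} [Fintype X] [DecidableEq X] {g : Equiv.Perm X}
    {a b : X} (hab : a ≠ b) (hb : g b = b) :
    2 * (Finset.univ.filter fun w : X → Bool => w ∘ ⇑(g * Equiv.swap a b) = w).card =
      (Finset.univ.filter fun w : X → Bool => w ∘ g = w).card := by
  have hiff : ∀ w : X → Bool, w ∘ ⇑(g * Equiv.swap a b) = w ↔ w ∘ g = w ∧ w a = w b := by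
    intro w
    have hcomp : w ∘ ⇑(g * Equiv.swap a b) = (w ∘ g) ∘ Equiv.swap a b := rfl
    constructor
    · intro h
      have h1 : w a = w b := by simpa [hb] using (congrFun h a).symm
      refine ⟨?_, h1⟩
      funext i
      have := congrFun h (Equiv.swap a b i)
      rw [← Function.comp_apply (f := w) (g := Equiv.swap a b), comp_swap_of_eq h1] at this
      simpa using this
    · rintro ⟨h1, h2⟩
      rw [hcomp, h1, comp_swap_of_eq h2]
  have hupd : ∀ (w : X → Bool) (v : Bool), w ∘ g = w →
      Function.update w b v ∘ g = Function.update w b v := by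
    intro w v h
    rw [Function.update_comp_equiv, h, (Equiv.symm_apply_eq g).2 hb.symm]
  rw [← Finset.card_filter_add_card_filter_not
    (s := Finset.univ.filter fun w : X → Bool => w ∘ g = w) (fun w => w a = w b),
    Finset.filter_filter, Finset.filter_filter, two_mul]
  simp only [hiff]
  congr 1
  refine Finset.card_nbij' (fun w => Function.update w b (!w b))
    (fun w => Function.update w b (!w b)) ?_ ?_ ?_ ?_
  · intro w hw
    simp only [Finset.coe_filter, Finset.mem_univ, true_and, Set.mem_ofPred_eq] at hw ⊢
    exact ⟨hupd w _ hw.1, by simp [hab, hw.2]⟩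
  · intro w hw
    simp only [Finset.coe_filter, Finset.mem_univ, true_and, Set.mem_ofPred_eq] at hw ⊢
    exact ⟨hupd w _ hw.1, by
      have := hw.2
      rw [← ne_eq, ← Bool.eq_not_iff] at this
      simpa [hab] using this⟩
  · intro w _
    simp
  · intro w _
    simp

end SymmetricGroup

section TL

variable {n : ℕ}

/-- The representation of the Temperley–Lieb algebra on functions of `n` boolean variables in
which `u_i` antisymmetrizes the variables `i` and `i + 1`. -/
noncomputable def tensorRep (n : ℕ) : TL ℚ n →ₐ[ℚ] Module.End ℚ ((Fin n → Bool) → ℚ) :=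
  RingQuot.liftAlgHom ℚ ⟨FreeAlgebra.lift ℚ fun i => 1 - placePerm n (simpleT n i), by
    rintro _ _ (i | ⟨i, j, h⟩ | ⟨i, j, h⟩)
    · simp only [map_mul, map_ofNat, FreeAlgebra.lift_ι_apply]
      have : placePerm n (simpleT n i) * placePerm n (simpleT n i) = 1 := by
        rw [← map_mul, simpleT, Equiv.swap_mul_self, map_one]
      noncomm_ring [this]
    · simp only [map_mul, FreeAlgebra.lift_ι_apply, simpleT]
      rcases i with ⟨i, hi⟩
      rcases j with ⟨j, hj⟩
      obtain rfl | rfl : j = i + 1 ∨ i = j + 1 := by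
        simp only [Nat.dist] at h
        omega
      · exact one_sub_placePerm_braid (by simp) (by simp) (by simp; omega)
      · rw [Equiv.swap_comm, Equiv.swap_comm (⟨j, _⟩ : Fin n)]
        exact one_sub_placePerm_braid (by simp) (by simp) (by simp; omega)
    · simp only [map_mul, FreeAlgebra.lift_ι_apply]
      have hdisj : Equiv.Perm.Disjoint (simpleT n i) (simpleT n j) := by
        have hij : (i : ℕ) + 1 < j ∨ (j : ℕ) + 1 < i := by
          simp only [Nat.dist] at h
          omega
        refine Equiv.Perm.disjoint_swap_swap ?_
        simp only [List.nodup_cons, List.mem_cons, Fin.mk.injEq, List.not_mem_nil]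
        simp
        omega
      have hcomm : Commute (placePerm n (simpleT n i)) (placePerm n (simpleT n j)) :=
        hdisj.commute.map _
      exact (((Commute.one_left _).sub_left
        ((Commute.one_right _).sub_right hcomm)).eq :)⟩

theorem tensorRep_TLu (i : Fin (n - 1)) :
    tensorRep n (TLu ℚ n i) = 1 - placePerm n (simpleT n i) := by
  simp [tensorRep, TLu]

theorem TLu_sq (i : Fin (n - 1)) : TLu ℚ n i * TLu ℚ n i = 2 * TLu ℚ n i := by
  simpa only [map_mul, map_ofNat, TLu] using RingQuot.mkAlgHom_rel ℚ (TLRel.sq (R := ℚ) i)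

theorem TLu_braid {i j : Fin (n - 1)} (h : Nat.dist i.val j.val = 1) :
    TLu ℚ n i * TLu ℚ n j * TLu ℚ n i = TLu ℚ n i := by
  simpa [TLu] using RingQuot.mkAlgHom_rel ℚ (TLRel.braid (R := ℚ) i j h)

theorem adjoin_range_TLu (n : ℕ) : Algebra.adjoin ℚ (Set.range (TLu ℚ n)) = ⊤ := by
  have h : Set.range (TLu ℚ n) =
      RingQuot.mkAlgHom ℚ (TLRel ℚ n) '' Set.range (FreeAlgebra.ι ℚ) := by
    rw [← Set.range_comp]
    rfl
  rw [h, ← AlgHom.map_adjoin, FreeAlgebra.adjoin_range_ι, Algebra.map_top,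
    AlgHom.range_eq_top]
  exact RingQuot.mkAlgHom_surjective _ _

/-- The trace of the representation `tensorRep`. -/
noncomputable def tensorTrace (n : ℕ) : TL ℚ n →ₗ[ℚ] ℚ :=
  ∑ w : Fin n → Bool, LinearMap.proj w ∘ₗ
    LinearMap.applyₗ (Pi.single w (1 : ℚ)) ∘ₗ (tensorRep n).toLinearMap

theorem tensorTrace_apply (x : TL ℚ n) :
    tensorTrace n x = ∑ w : Fin n → Bool, tensorRep n x (Pi.single w 1) w := by
  simp [tensorTrace]

variable {β : Equiv.Perm (Fin n) →* TL ℚ n}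

theorem satisfiesTL_of_map_simpleT (hβ : ∀ i, β (simpleT n i) = TLu ℚ n i - 1) :
    SatisfiesTL β := by
  intro k hk
  have h1 := hβ ⟨k, by omega⟩
  have h2 := hβ ⟨k + 1, by omega⟩
  simp only [simpleT] at h1 h2
  rw [h1, h2, add_sub_cancel, mul_sub, sub_mul, mul_one, TLu_sq, TLu_braid (by simp [Nat.dist])]
  noncomm_ring

theorem youngAlgebra_eq_top (hβ : ∀ i, β (simpleT n i) = TLu ℚ n i - 1) :
    youngAlgebra β n = ⊤ := by
  rw [eq_top_iff, ← adjoin_range_TLu, Algebra.adjoin_le_iff]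
  rintro _ ⟨i, rfl⟩
  have : TLu ℚ n i = β (simpleT n i) + 1 := by rw [hβ]; simp
  rw [this]
  exact add_mem (map_mem_youngAlgebra (swap_mem_youngSubgroup (Fin.is_lt _) (Fin.is_lt _)))
    (one_mem _)

theorem tensorRep_map (hβ : ∀ i, β (simpleT n i) = TLu ℚ n i - 1)
    (g : Equiv.Perm (Fin n)) :
    tensorRep n (β g) = ((Equiv.Perm.sign g : ℤ) : ℚ) • placePerm n g := by
  let γ : Equiv.Perm (Fin n) →* Module.End ℚ ((Fin n → Bool) → ℚ) :=
    { toFun := fun g => ((Equiv.Perm.sign g : ℤ) : ℚ) • placePerm n g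
      map_one' := by simp
      map_mul' := fun g h => by simp [smul_smul, mul_comm] }
  refine DFunLike.congr_fun (f := (tensorRep n : TL ℚ n →* _).comp β) (g := γ) ?_ g
  refine MonoidHom.eq_of_eqOn_denseM (mclosure_range_simpleT n) ?_
  rintro _ ⟨i, rfl⟩
  have hsign : ((Equiv.Perm.sign (simpleT n i) : ℤ) : ℚ) = -1 := by
    rw [simpleT, Equiv.Perm.sign_swap (by simp)]
    simp
  change tensorRep n (β (simpleT n i)) =
    ((Equiv.Perm.sign (simpleT n i) : ℤ) : ℚ) • placePerm n (simpleT n i)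
  rw [hβ, map_sub, tensorRep_TLu, map_one, hsign, sub_sub_cancel_left]
  ext f w
  simp

theorem tensorTrace_map (hβ : ∀ i, β (simpleT n i) = TLu ℚ n i - 1)
    (g : Equiv.Perm (Fin n)) :
    tensorTrace n (β g) = ((Equiv.Perm.sign g : ℤ) : ℚ) *
      (Finset.univ.filter fun w : Fin n → Bool => w ∘ g = w).card := by
  simp only [tensorTrace_apply, tensorRep_map hβ, LinearMap.smul_apply, Pi.smul_apply,
    placePerm_apply, smul_eq_mul, ← Finset.mul_sum, Pi.single_apply, Finset.sum_boole]

theorem tensorTrace_mul_jucysMurphy (hβ : ∀ i, β (simpleT n i) = TLu ℚ n i - 1)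
    {k : ℕ} (hk : k < n) {x : TL ℚ n} (hx : x ∈ youngAlgebra β k) :
    tensorTrace n (x * jucysMurphy β k) = -(k / 2 : ℚ) * tensorTrace n x := by
  refine youngAlgebra_induction (N := LinearMap.eqLocus
    (tensorTrace n ∘ₗ LinearMap.mulRight ℚ (jucysMurphy β k))
    (-(k / 2 : ℚ) • tensorTrace n)) (fun g hg => ?_) hx
  rw [LinearMap.mem_eqLocus, LinearMap.comp_apply, LinearMap.mulRight_apply, LinearMap.smul_apply,
    jucysMurphy_of_lt hk, Finset.mul_sum, map_sum]
  have key : ∀ j ∈ initialPoints n k, tensorTrace n (β g * β (Equiv.swap j ⟨k, hk⟩)) =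
      -(1 / 2 : ℚ) * tensorTrace n (β g) := by
    intro j hj
    have hne : j ≠ ⟨k, hk⟩ := by
      rintro rfl
      simp at hj
    rw [← map_mul, tensorTrace_map hβ, tensorTrace_map hβ,
      ← two_mul_card_fixed_mul_swap hne (mem_youngSubgroup.1 hg _ le_rfl), Equiv.Perm.sign_mul,
      Equiv.Perm.sign_swap hne]
    push_cast
    ring
  rw [Finset.sum_congr rfl key, Finset.sum_const, card_initialPoints hk.le, nsmul_eq_mul,
    smul_eq_mul]
  ring

theorem tensorTrace_seminormal_pos (hβ : ∀ i, β (simpleT n i) = TLu ℚ n i - 1)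
    {w : ℕ → Fin 2} (hw : IsBallot w n) :
    0 < tensorTrace n (seminormal β w n) := by
  refine map_seminormal_pos _ ?_ (fun k hk x hx => tensorTrace_mul_jucysMurphy hβ hk hx) le_rfl hw
  rw [← map_one β, tensorTrace_map hβ]
  simp

end TL

section Tableau

variable {n : ℕ}

theorem card_filter_le_eq_count (w : ℕ → Fin 2) (c : Fin 2) (j : Fin n) :
    (Finset.univ.filter fun i : Fin n => i ≤ j ∧ w i = c).card =
      Nat.count (w · = c) (j + 1) := by
  rw [Nat.count_eq_card_filter_range, ← Finset.card_map Fin.valEmbedding]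
  congr 1
  ext m
  simp only [Finset.mem_map, Finset.mem_filter, Finset.mem_univ, true_and, Fin.valEmbedding_apply,
    Finset.mem_range]
  constructor
  · rintro ⟨i, ⟨hi, hc⟩, rfl⟩
    exact ⟨Nat.lt_succ_iff.2 hi, hc⟩
  · rintro ⟨hm, hc⟩
    exact ⟨⟨m, by omega⟩, ⟨Fin.mk_le_of_le_val (by omega), hc⟩, rfl⟩

theorem colContent_eq_wordContent (w : ℕ → Fin 2) (j : Fin n) :
    (colContent (fun i : Fin n => w i) j : ℚ) = wordContent w j := by
  rw [colContent, wordContent, card_filter_le_eq_count, card_filter_le_eq_count]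
  split_ifs with h
  · rw [Nat.count_succ, if_pos h]
    push_cast
    ring
  · rw [Nat.count_succ, if_pos (by omega)]
    push_cast
    ring

theorem isBallot_iff {w : ℕ → Fin 2} :
    IsBallot w n ↔ ∀ m : Fin n,
      (Finset.univ.filter fun i : Fin n => i ≤ m ∧ w i = 1).card ≤
      (Finset.univ.filter fun i : Fin n => i ≤ m ∧ w i = 0).card := by
  simp only [card_filter_le_eq_count]
  constructor
  · exact fun h m => h _ m.isLt
  · intro h m hm
    cases m with
    | zero => simp
    | succ m => exact h ⟨m, hm⟩

theorem colContent_mem_contSet {w : ℕ → Fin 2} (hw : IsBallot w n) (j : Fin n) :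
    colContent (fun i : Fin n => w i) j ∈ ContSet n := by
  refine Finset.mem_image.2 ⟨(fun i : Fin n => w i, j), ?_, rfl⟩
  rw [Finset.mem_filter]
  exact ⟨Finset.mem_univ _, isBallot_iff.1 hw⟩

/-- The column word of a two-column tableau, extended by `0`. -/
def TwoColTab.word (t : TwoColTab n) (i : ℕ) : Fin 2 :=
  if h : i < n then t.col ⟨i, h⟩ else 0

theorem TwoColTab.col_eq (t : TwoColTab n) : t.col = fun i : Fin n => t.word i := by
  funext i
  simp [TwoColTab.word]

theorem TwoColTab.isBallot_word (t : TwoColTab n) : IsBallot t.word n := by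
  have := t.ballot
  rw [t.col_eq] at this
  exact isBallot_iff.2 this

variable {β : Equiv.Perm (Fin n) →* TL ℚ n}

theorem EeltC_mul_seminormal (hS : SeminormalSpec β n) (c : Fin n → Fin 2) {r : ℕ → Fin 2}
    (hr : IsBallot r n) :
    EeltC n (fun l => jucysMurphy β l) c * seminormal β r n =
      (((ContSet n).sort (· ≤ ·)).map fun d =>
        (((List.finRange n).filter fun i => colContent c i ≠ d).map fun i =>
          ((colContent c i - d : ℤ) : ℚ)⁻¹ *
            ((colContent (fun i : Fin n => r i) i - d : ℤ) : ℚ)).prod).prod •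
        seminormal β r n := by
  refine list_prod_map_mul_eq_smul fun d _ => list_prod_map_mul_eq_smul fun i _ => ?_
  rw [smul_mul_assoc, sub_mul, hS r hr i i.isLt, mul_smul, Int.cast_sub, Int.cast_sub,
    colContent_eq_wordContent, sub_smul, Int.cast_smul_eq_zsmul, ← zsmul_eq_mul]

theorem EeltC_eq_seminormal (hTL : SatisfiesTL β) {w : ℕ → Fin 2} (hw : IsBallot w n) :
    EeltC n (fun l => jucysMurphy β l) (fun i : Fin n => w i) = seminormal β w n := by
  have hS := (seminormalSpec_and_complete hTL le_rfl).1
  refine eq_seminormal_of_mul hTL le_rfl hw ?_ fun r hr j hj hne => ?_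
  · rw [EeltC_mul_seminormal hS _ hw, List.prod_eq_one, one_smul]
    simp only [List.mem_map, forall_exists_index, and_imp]
    rintro _ d _ rfl
    refine List.prod_eq_one ?_
    simp only [List.mem_map, forall_exists_index, and_imp]
    rintro _ i hi rfl
    have hi' := (List.mem_filter.1 hi).2
    rw [decide_eq_true_iff] at hi'
    exact inv_mul_cancel₀ (Int.cast_ne_zero.2 (sub_ne_zero.2 hi'))
  · rw [EeltC_mul_seminormal hS _ hr, List.prod_eq_zero, zero_smul]
    refine List.mem_map.2 ⟨colContent (fun i : Fin n => r i) ⟨j, hj⟩,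
      (Finset.mem_sort _).2 (colContent_mem_contSet hr _), List.prod_eq_zero ?_⟩
    refine List.mem_map.2 ⟨⟨j, hj⟩, List.mem_filter.2 ⟨List.mem_finRange _, ?_⟩, by simp⟩
    rw [decide_eq_true_iff]
    intro h
    refine hne ?_
    rw [← colContent_eq_wordContent w ⟨j, hj⟩, h, colContent_eq_wordContent]

end Tableau

/-- For every two-column standard tableau `t` of size `n`, the
seminormal element `E_t ∈ TL_n^ℚ` is a primitive idempotent: it is a nonzero
idempotent which cannot be written as `e + e'` with `e, e'` nonzero idempotents
satisfying `e·e' = e'·e = 0`. -/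
theorem Eelt_primitive_idempotent (n : ℕ)
    (Φ : SymGrpAlg ℚ n →ₐ[ℚ] TL ℚ n)
    (hΦ : ∀ i : Fin (n - 1),
      Φ (MonoidAlgebra.of ℚ (Equiv.Perm (Fin n)) (simpleT n i)) = TLu ℚ n i - 1)
    (t : TwoColTab n) :
    Eelt n (fun l => Φ (JMelt ℚ n l)) t ≠ 0 ∧
    IsIdempotentElem (Eelt n (fun l => Φ (JMelt ℚ n l)) t) ∧
    ¬ ∃ e e' : TL ℚ n, e ≠ 0 ∧ e' ≠ 0 ∧ IsIdempotentElem e ∧ IsIdempotentElem e' ∧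
        e * e' = 0 ∧ e' * e = 0 ∧ Eelt n (fun l => Φ (JMelt ℚ n l)) t = e + e' := by
  let β : Equiv.Perm (Fin n) →* TL ℚ n :=
    (Φ : SymGrpAlg ℚ n →* TL ℚ n).comp (MonoidAlgebra.of ℚ (Equiv.Perm (Fin n)))
  have hTL : SatisfiesTL β := satisfiesTL_of_map_simpleT hΦ
  have hw := t.isBallot_word
  have hL : (fun l => Φ (JMelt ℚ n l)) = fun l : Fin n => jucysMurphy β l := by
    funext l
    rw [jucysMurphy_of_lt l.isLt, JMelt, map_sum]
    rfl
  have hE : Eelt n (fun l => Φ (JMelt ℚ n l)) t = seminormal β t.word n := by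
    rw [hL, Eelt, t.col_eq, EeltC_eq_seminormal hTL hw]
  rw [hE]
  have hidem : seminormal β t.word n * seminormal β t.word n = seminormal β t.word n :=
    (seminormalSpec_and_complete hTL le_rfl).1.seminormal_mul hw le_rfl
  refine ⟨fun h => ?_, hidem, not_exists_orthogonal_decomposition hidem fun x => ?_⟩
  · have hpos := tensorTrace_seminormal_pos hΦ hw (β := β)
    rw [h, map_zero] at hpos
    exact hpos.false
  · exact seminormal_mul_mul_mem_span hTL le_rfl hw (by
      rw [youngAlgebra_eq_top hΦ]
      exact Algebra.mem_top)
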